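/- arXiv:2410.10914 — 4 statements merged into one kernel-verified Lean document; each statement's English description precedes it below -/
import Mathlib

section
/- Let X ∈ ℝ^{N×C}, let W ∈ ℝ^{C×C} have columns w_1,…,w_C, let P_1,…,P_C be N×N permutation matrices, and let Y = CSP_W(X) be the N×C matrix whose c-th column is P_c X w_c. Then r₁(Y) ≤ ‖W‖₁ · r₁(X). -/
open scoped BigOperators

/-- Maximum absolute column sum norm `‖X‖₁` of an `N × C` real matrix. -/
noncomputable def colNorm {N C : ℕ} (X : Matrix (Fin N) (Fin C) ℝ) : ℝ :=
  ⨆ c : Fin C, ∑ n : Fin N, |X n c|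

/-- Maximum absolute row sum norm `‖X‖_∞` of an `N × C` real matrix. -/
noncomputable def rowNorm {N C : ℕ} (X : Matrix (Fin N) (Fin C) ℝ) : ℝ :=
  ⨆ n : Fin N, ∑ c : Fin C, |X n c|

/-- Rank-one residual `r₁(X) = inf_x ‖X − 1_N x^⊤‖₁`. -/
noncomputable def r1 {N C : ℕ} (X : Matrix (Fin N) (Fin C) ℝ) : ℝ :=
  ⨅ x : Fin C → ℝ, colNorm (X - Matrix.of fun _ c => x c)

/-- Rank-one residual `r_∞(X) = inf_x ‖X − 1_N x^⊤‖_∞`. -/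
noncomputable def rInf {N C : ℕ} (X : Matrix (Fin N) (Fin C) ℝ) : ℝ :=
  ⨅ x : Fin C → ℝ, rowNorm (X - Matrix.of fun _ c => x c)

/-- `r_{1,∞}(X) = √(r₁(X) · r_∞(X))`. -/
noncomputable def r1Inf {N C : ℕ} (X : Matrix (Fin N) (Fin C) ℝ) : ℝ :=
  Real.sqrt (r1 X * rInf X)

/-- `P` is a permutation matrix. -/
def IsPermMatrix {N : ℕ} (P : Matrix (Fin N) (Fin N) ℝ) : Prop :=
  ∃ σ : Equiv.Perm (Fin N), ∀ i j, P i j = if i = σ j then 1 else 0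

/-- The CSP operator: the `c`-th column of `CSP P W X` is `P_c X w_c`,
where `w_c` is the `c`-th column of `W`. -/
noncomputable def CSP {N C : ℕ} (P : Fin C → Matrix (Fin N) (Fin N) ℝ)
    (W : Matrix (Fin C) (Fin C) ℝ) (X : Matrix (Fin N) (Fin C) ℝ) :
    Matrix (Fin N) (Fin C) ℝ :=
  Matrix.of fun n c => (P c).mulVec (X.mulVec fun r => W r c) n

theorem colNorm_nonneg {N C : ℕ} (X : Matrix (Fin N) (Fin C) ℝ) : 0 ≤ colNorm X :=
  Real.iSup_nonneg fun _ => Finset.sum_nonneg fun _ _ => abs_nonneg _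

theorem sum_abs_le_colNorm {N C : ℕ} (X : Matrix (Fin N) (Fin C) ℝ) (c : Fin C) :
    ∑ n, |X n c| ≤ colNorm X :=
  le_ciSup (f := fun c => ∑ n, |X n c|) (Set.finite_range _).bddAbove c

theorem IsPermMatrix.exists_mulVec {N : ℕ} {P : Matrix (Fin N) (Fin N) ℝ}
    (hP : IsPermMatrix P) :
    ∃ σ : Equiv.Perm (Fin N), ∀ v n, P.mulVec v n = v (σ n) := by
  obtain ⟨σ, hσ⟩ := hP
  refine ⟨σ.symm, fun v n => ?_⟩
  simp [Matrix.mulVec, dotProduct, hσ, ← Equiv.symm_apply_eq]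

theorem CSP_sub {N C : ℕ} (P : Fin C → Matrix (Fin N) (Fin N) ℝ)
    (W : Matrix (Fin C) (Fin C) ℝ) (X Z : Matrix (Fin N) (Fin C) ℝ) :
    CSP P W (X - Z) = CSP P W X - CSP P W Z := by
  ext n c
  simp [CSP, Matrix.sub_mulVec, Matrix.mulVec_sub]

theorem CSP_of_const_rows {N C : ℕ} {P : Fin C → Matrix (Fin N) (Fin N) ℝ}
    (hP : ∀ c, IsPermMatrix (P c)) (W : Matrix (Fin C) (Fin C) ℝ) (x : Fin C → ℝ) :
    CSP P W (Matrix.of fun _ c => x c) = Matrix.of fun _ c => ∑ r, x r * W r c := by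
  ext n c
  obtain ⟨σ, hσ⟩ := (hP c).exists_mulVec
  simp only [CSP, Matrix.of_apply, hσ]
  simp only [Matrix.mulVec, dotProduct, Matrix.of_apply]

/-- The CSP operator is bounded by `‖W‖₁` in the maximum absolute column sum norm. -/
theorem colNorm_CSP_le {N C : ℕ} {P : Fin C → Matrix (Fin N) (Fin N) ℝ}
    (hP : ∀ c, IsPermMatrix (P c)) (W : Matrix (Fin C) (Fin C) ℝ)
    (X : Matrix (Fin N) (Fin C) ℝ) :
    colNorm (CSP P W X) ≤ colNorm W * colNorm X := by
  refine Real.iSup_le (fun c => ?_) (mul_nonneg (colNorm_nonneg W) (colNorm_nonneg X))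
  obtain ⟨σ, hσ⟩ := (hP c).exists_mulVec
  calc ∑ n, |CSP P W X n c|
      = ∑ n, |∑ r, X (σ n) r * W r c| := by
        simp only [CSP, Matrix.of_apply, hσ]
        simp only [Matrix.mulVec, dotProduct]
    _ = ∑ n, |∑ r, X n r * W r c| := Equiv.sum_comp σ fun n => |∑ r, X n r * W r c|
    _ ≤ ∑ n, ∑ r, |X n r * W r c| :=
        Finset.sum_le_sum fun n _ => Finset.abs_sum_le_sum_abs _ _
    _ = ∑ r, |W r c| * ∑ n, |X n r| := by
        rw [Finset.sum_comm]
        simp only [abs_mul, Finset.mul_sum, mul_comm]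
    _ ≤ ∑ r, |W r c| * colNorm X := by
        gcongr with r
        exact sum_abs_le_colNorm X r
    _ = (∑ r, |W r c|) * colNorm X := (Finset.sum_mul _ _ _).symm
    _ ≤ colNorm W * colNorm X :=
        mul_le_mul_of_nonneg_right (sum_abs_le_colNorm W c) (colNorm_nonneg X)

/-- `r₁(CSP_W(X)) ≤ ‖W‖₁ · r₁(X)`. -/
theorem stmt1 {N C : ℕ} (X : Matrix (Fin N) (Fin C) ℝ)
    (W : Matrix (Fin C) (Fin C) ℝ) (P : Fin C → Matrix (Fin N) (Fin N) ℝ)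
    (hP : ∀ c, IsPermMatrix (P c)) :
    r1 (CSP P W X) ≤ colNorm W * r1 X := by
  rw [r1, r1, Real.mul_iInf_of_nonneg (colNorm_nonneg W)]
  refine le_ciInf fun x => ?_
  refine (ciInf_le ⟨0, ?_⟩ fun c => ∑ r, x r * W r c).trans ?_
  · rintro _ ⟨y, rfl⟩
    exact colNorm_nonneg _
  · rw [← CSP_of_const_rows hP, ← CSP_sub]
    exact colNorm_CSP_le hP W _
end

section
/- Let X ∈ ℝ^{N×C}, let W ∈ ℝ^{C×C} have columns w_1,…,w_C, let P_1,…,P_C be N×N permutation matrices, and let Y = CSP_W(X) be the N×C matrix whose c-th column is P_c X w_c. Then r_∞(Y) ≤ C · ‖W‖₁ · r_∞(X). -/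
open scoped BigOperators

theorem rowNorm_nonneg {N C : ℕ} (X : Matrix (Fin N) (Fin C) ℝ) : 0 ≤ rowNorm X :=
  Real.iSup_nonneg fun _ => Finset.sum_nonneg fun _ _ => abs_nonneg _

theorem abs_le_rowNorm {N C : ℕ} (X : Matrix (Fin N) (Fin C) ℝ) (n : Fin N) (c : Fin C) :
    |X n c| ≤ rowNorm X :=
  (Finset.single_le_sum (f := fun c => |X n c|) (fun _ _ => abs_nonneg _)
    (Finset.mem_univ c)).trans
    (le_ciSup (f := fun n => ∑ c, |X n c|) (Set.finite_range _).bddAbove n)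

theorem IsPermMatrix.exists_mulVec_eq {N : ℕ} {P : Matrix (Fin N) (Fin N) ℝ}
    (hP : IsPermMatrix P) (n : Fin N) : ∃ m, ∀ v : Fin N → ℝ, P.mulVec v n = v m := by
  obtain ⟨σ, hσ⟩ := hP
  refine ⟨σ.symm n, fun v => ?_⟩
  simp [Matrix.mulVec, dotProduct, hσ, ← Equiv.symm_apply_eq]

/-- Shifting the rows of `X` by `x` shifts the rows of `CSP P W X` by `x ᵥ* W`. -/
theorem rowNorm_CSP_sub_le {N C : ℕ} (X : Matrix (Fin N) (Fin C) ℝ)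
    (W : Matrix (Fin C) (Fin C) ℝ) (P : Fin C → Matrix (Fin N) (Fin N) ℝ)
    (hP : ∀ c, IsPermMatrix (P c)) (x : Fin C → ℝ) :
    rowNorm (CSP P W X - Matrix.of fun _ c => ∑ r, x r * W r c) ≤
      (C : ℝ) * colNorm W * rowNorm (X - Matrix.of fun _ c => x c) := by
  set R := X - Matrix.of fun _ c => x c with hR
  refine Real.iSup_le (fun n => ?_)
    (mul_nonneg (mul_nonneg C.cast_nonneg (colNorm_nonneg W)) (rowNorm_nonneg R))
  have entry_le (c : Fin C) :
      |(CSP P W X - Matrix.of fun _ c => ∑ r, x r * W r c : Matrix (Fin N) (Fin C) ℝ) n c| ≤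
        colNorm W * rowNorm R := by
    obtain ⟨m, hm⟩ := (hP c).exists_mulVec_eq n
    have entry_eq :
        (CSP P W X - Matrix.of fun _ c => ∑ r, x r * W r c : Matrix (Fin N) (Fin C) ℝ) n c =
          ∑ r, W r c * R m r := by
      simp only [CSP, Matrix.sub_apply, Matrix.of_apply, hm, hR]
      simp only [Matrix.mulVec, dotProduct, ← Finset.sum_sub_distrib]
      exact Finset.sum_congr rfl fun r _ => by ring
    calc _ = |∑ r, W r c * R m r| := by rw [entry_eq]
      _ ≤ ∑ r, |W r c * R m r| := Finset.abs_sum_le_sum_abs _ _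
      _ ≤ ∑ r, |W r c| * rowNorm R := Finset.sum_le_sum fun r _ => by
          rw [abs_mul]
          exact mul_le_mul_of_nonneg_left (abs_le_rowNorm R m r) (abs_nonneg _)
      _ = (∑ r, |W r c|) * rowNorm R := (Finset.sum_mul _ _ _).symm
      _ ≤ colNorm W * rowNorm R :=
          mul_le_mul_of_nonneg_right (sum_abs_le_colNorm W c) (rowNorm_nonneg R)
  calc _ ≤ ∑ _c : Fin C, colNorm W * rowNorm R := Finset.sum_le_sum fun c _ => entry_le c
    _ = C * colNorm W * rowNorm R := by simp [mul_assoc]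

/-- `r_∞(CSP_W(X)) ≤ C · ‖W‖₁ · r_∞(X)`. -/
theorem stmt2 {N C : ℕ} (X : Matrix (Fin N) (Fin C) ℝ)
    (W : Matrix (Fin C) (Fin C) ℝ) (P : Fin C → Matrix (Fin N) (Fin N) ℝ)
    (hP : ∀ c, IsPermMatrix (P c)) :
    rInf (CSP P W X) ≤ (C : ℝ) * colNorm W * rInf X := by
  have hbdd : BddBelow (Set.range fun y : Fin C → ℝ =>
      rowNorm (CSP P W X - Matrix.of fun _ c => y c)) :=
    ⟨0, by rintro _ ⟨y, rfl⟩; exact rowNorm_nonneg _⟩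
  rw [rInf, rInf, Real.mul_iInf_of_nonneg (mul_nonneg C.cast_nonneg (colNorm_nonneg W))]
  exact le_ciInf fun x =>
    (ciInf_le hbdd fun c => ∑ r, x r * W r c).trans (rowNorm_CSP_sub_le X W P hP x)
end

section
/- Let f: ℝ^C → ℝ^C be λ-Lipschitz with respect to the ℓ1 norm on ℝ^C, and let F: ℝ^{N×C} → ℝ^{N×C} apply f to each row, i.e., the n-th row of F(Y) is f(y_n) where y_n is the n-th row of Y. Then for every Y ∈ ℝ^{N×C}, r_∞(F(Y)) ≤ λ · r_∞(Y). -/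
open scoped BigOperators

theorem sum_abs_le_rowNorm {N C : ℕ} (X : Matrix (Fin N) (Fin C) ℝ) (n : Fin N) :
    ∑ c, |X n c| ≤ rowNorm X :=
  le_ciSup (f := fun n => ∑ c, |X n c|) (Set.finite_range _).bddAbove n

theorem rInf_le_rowNorm {N C : ℕ} (X : Matrix (Fin N) (Fin C) ℝ) (x : Fin C → ℝ) :
    rInf X ≤ rowNorm (X - Matrix.of fun _ c => x c) :=
  ciInf_le ⟨0, Set.forall_mem_range.2 fun _ => rowNorm_nonneg _⟩ x

/-- if `f : ℝ^C → ℝ^C` is `λ`-Lipschitz for the `ℓ1` norm and `F` applies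
`f` to each row, then `r_∞(F(Y)) ≤ λ · r_∞(Y)`. -/
theorem stmt4 {N C : ℕ} (f : (Fin C → ℝ) → (Fin C → ℝ)) (lam : ℝ)
    (hf : ∀ u v : Fin C → ℝ, ∑ c, |f u c - f v c| ≤ lam * ∑ c, |u c - v c|)
    (Y : Matrix (Fin N) (Fin C) ℝ) :
    rInf (Matrix.of fun n c => f (Y n) c) ≤ lam * rInf Y := by
  rcases Nat.eq_zero_or_pos C with rfl | hC
  · simp [rInf, rowNorm]
  have hlam : 0 ≤ lam := by
    have h : 0 ≤ lam * ∑ c : Fin C, |(1 : Fin C → ℝ) c - (0 : Fin C → ℝ) c| :=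
      (Finset.sum_nonneg fun _ _ => abs_nonneg _).trans (hf 1 0)
    refine nonneg_of_mul_nonneg_left h ?_
    simpa using hC
  rw [rInf.eq_def Y, Real.mul_iInf_of_nonneg hlam]
  refine le_ciInf fun x => (rInf_le_rowNorm _ (f x)).trans ?_
  refine Real.iSup_le (fun n => ?_) (mul_nonneg hlam (rowNorm_nonneg _))
  exact (hf (Y n) x).trans (mul_le_mul_of_nonneg_left
    (sum_abs_le_rowNorm (Y - Matrix.of fun _ c => x c) n) hlam)
end

section
/- For c = 1,…,C let g_c: ℝ → ℝ be λ-Lipschitz, and let G: ℝ^{N×C} → ℝ^{N×C} act entrywise, i.e., G(Y)_{nc} = g_c(y_{nc}). Then for every Y ∈ ℝ^{N×C}, r₁(G(Y)) ≤ λ · r₁(Y) and r_∞(G(Y)) ≤ λ · r_∞(Y). -/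
open scoped BigOperators

theorem colNorm_le_mul {N C : ℕ} {X Y : Matrix (Fin N) (Fin C) ℝ} {lam : ℝ} (hlam : 0 ≤ lam)
    (h : ∀ n c, |X n c| ≤ lam * |Y n c|) : colNorm X ≤ lam * colNorm Y := by
  unfold colNorm
  rw [Real.mul_iSup_of_nonneg hlam]
  refine ciSup_mono (Set.finite_range _).bddAbove fun c => ?_
  rw [Finset.mul_sum]
  exact Finset.sum_le_sum fun n _ => h n c

theorem rowNorm_le_mul {N C : ℕ} {X Y : Matrix (Fin N) (Fin C) ℝ} {lam : ℝ} (hlam : 0 ≤ lam)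
    (h : ∀ n c, |X n c| ≤ lam * |Y n c|) : rowNorm X ≤ lam * rowNorm Y := by
  unfold rowNorm
  rw [Real.mul_iSup_of_nonneg hlam]
  refine ciSup_mono (Set.finite_range _).bddAbove fun n => ?_
  rw [Finset.mul_sum]
  exact Finset.sum_le_sum fun c _ => h n c

/-- if each `g_c : ℝ → ℝ` is `λ`-Lipschitz and `G` acts entrywise,
`G(Y)_{nc} = g_c(y_{nc})`, then `r₁(G(Y)) ≤ λ r₁(Y)` and `r_∞(G(Y)) ≤ λ r_∞(Y)`. -/
theorem stmt5 {N C : ℕ} (g : Fin C → ℝ → ℝ) (lam : ℝ)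
    (hg : ∀ c : Fin C, ∀ s t : ℝ, |g c s - g c t| ≤ lam * |s - t|)
    (Y : Matrix (Fin N) (Fin C) ℝ) :
    r1 (Matrix.of fun n c => g c (Y n c)) ≤ lam * r1 Y ∧
    rInf (Matrix.of fun n c => g c (Y n c)) ≤ lam * rInf Y := by
  rcases isEmpty_or_nonempty (Fin C) with hC | ⟨⟨c₀⟩⟩
  · simp [r1, rInf, colNorm, rowNorm]
  have hlam : 0 ≤ lam := by simpa using (abs_nonneg _).trans (hg c₀ 1 0)
  constructor
  · unfold r1
    rw [Real.mul_iInf_of_nonneg hlam]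
    exact le_ciInf fun x => ciInf_le_of_le ⟨0, Set.forall_mem_range.2 fun _ => colNorm_nonneg _⟩
      (fun c => g c (x c)) (colNorm_le_mul hlam fun n c => hg c (Y n c) (x c))
  · unfold rInf
    rw [Real.mul_iInf_of_nonneg hlam]
    exact le_ciInf fun x => ciInf_le_of_le ⟨0, Set.forall_mem_range.2 fun _ => rowNorm_nonneg _⟩
      (fun c => g c (x c)) (rowNorm_le_mul hlam fun n c => hg c (Y n c) (x c))
end
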